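/- There exists a universal constant c > 0 with the following property. Let (T, d) be a countable pseudometric space of finite diameter diam T := sup_{s,t∈T} d(s,t), and let (Z_t)_{t∈T} be a family of real random variables on a common probability space such that for all s, t ∈ T and all z > 0, P(|Z_s − Z_t| > z) ≤ 2·exp(−z²/(2·d(s,t)²)) (with the convention that the bound is vacuous when d(s,t) = 0, in which case Z_s = Z_t almost surely). Then ‖ sup_{s,t∈T} |Z_s − Z_t| ‖_{ψ₂} ≤ c · ∫₀^{diam T} √(log N(ε/2, T, d)) dε. -/

import Mathlib

open MeasureTheory Real

/-- The ψ₂-Orlicz norm of a real random variable `Z` with respect to a measure `μ`: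
`inf {c > 0 : E[exp(Z²/c²) − 1] ≤ 1}`, with the convention `inf ∅ = ∞`. -/
noncomputable def psi2OrliczNorm {Ω : Type*} [MeasurableSpace Ω] (μ : Measure Ω)
    (Z : Ω → ℝ) : ENNReal :=
  ⨅ (c : ℝ) (_ : 0 < c)
    (_ : ∫⁻ ω, ENNReal.ofReal (Real.exp ((Z ω) ^ 2 / c ^ 2) - 1) ∂μ ≤ 1),
    ENNReal.ofReal c

/-- The `ε`-covering number of a set `T` with respect to a pseudometric `d`: the minimal
cardinality of a finite subset `S ⊆ T` such that every point of `T` is within distance `ε`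
of some point of `S` (equal to `∞` if no finite cover exists). -/
noncomputable def coveringNumber {α : Type*} (ε : ℝ) (T : Set α) (d : α → α → ℝ) : ENNReal :=
  sInf {n : ENNReal | ∃ S : Finset α, ↑S ⊆ T ∧ (S.card : ENNReal) = n ∧
    ∀ t ∈ T, ∃ s ∈ S, d t s ≤ ε}

lemma cov_attained {T : Type} (d : T → T → ℝ) (u : ℝ)
    (h : coveringNumber u (Set.univ : Set T) d ≠ ⊤) :
    ∃ S : Finset T, (S.card : ENNReal) = coveringNumber u (Set.univ : Set T) d ∧
      ∀ t, ∃ s ∈ S, d t s ≤ u := by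
  classical
  have hex : ∃ n : ℕ, ∃ S : Finset T, S.card = n ∧ ∀ t, ∃ s ∈ S, d t s ≤ u := by
    by_contra hcon
    apply h
    unfold coveringNumber
    rw [sInf_eq_top]
    rintro a ⟨S, -, -, h3⟩
    exact absurd ⟨S.card, S, rfl, fun t => h3 t (Set.mem_univ t)⟩ hcon
  obtain ⟨S, hS, hc⟩ := Nat.find_spec hex
  refine ⟨S, le_antisymm ?_ ?_, hc⟩
  · unfold coveringNumber
    apply le_sInf
    rintro a ⟨S', -, rfl, h3⟩
    rw [hS]
    exact_mod_cast Nat.find_min' hex ⟨S', rfl, fun t => h3 t (Set.mem_univ t)⟩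
  · unfold coveringNumber
    exact sInf_le ⟨S, Set.subset_univ _, rfl, fun t _ => hc t⟩

lemma cov_anti {T : Type} (d : T → T → ℝ) {u v : ℝ} (huv : u ≤ v) :
    coveringNumber v (Set.univ : Set T) d ≤ coveringNumber u (Set.univ : Set T) d := by
  unfold coveringNumber
  apply sInf_le_sInf
  rintro a ⟨S, h1, h2, h3⟩
  exact ⟨S, h1, h2, fun t ht => (h3 t ht).imp fun s hs => ⟨hs.1, hs.2.trans huv⟩⟩

/-- The integrand. -/
noncomputable def entG {T : Type} (d : T → T → ℝ) (ε : ℝ) : ENNReal :=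
  if coveringNumber (ε / 2) (Set.univ : Set T) d = ⊤ then (⊤ : ENNReal)
  else ENNReal.ofReal
    (Real.sqrt (Real.log ((coveringNumber (ε / 2) (Set.univ : Set T) d).toReal)))

lemma entG_anti {T : Type} [Nonempty T] (d : T → T → ℝ) {u v : ℝ} (huv : u ≤ v) :
    entG d v ≤ entG d u := by
  have h := cov_anti d (show u / 2 ≤ v / 2 by linarith)
  unfold entG
  by_cases hu : coveringNumber (u / 2) (Set.univ : Set T) d = ⊤
  · simp [hu]
  have hv : coveringNumber (v / 2) (Set.univ : Set T) d ≠ ⊤ := ne_top_of_le_ne_top hu h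
  rw [if_neg hu, if_neg hv]
  apply ENNReal.ofReal_le_ofReal
  apply Real.sqrt_le_sqrt
  apply Real.log_le_log
  · obtain ⟨S, h1, h2⟩ := cov_attained d _ hv
    rw [← h1]
    obtain ⟨s, hs, -⟩ := h2 (Classical.arbitrary T)
    simpa using Finset.card_pos.2 ⟨s, hs⟩
  · exact ENNReal.toReal_mono hu h

lemma ent_sum {T : Type} [Nonempty T] (d : T → T → ℝ) {D : ℝ} (hD : 0 < D) (n : ℕ) :
    ∑ k ∈ Finset.range n, ENNReal.ofReal (D * (1/2)^(k+2)) * entG d (D * (1/2)^(k+1)) ≤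
      ∫⁻ ε in Set.Ioc (D * (1/2)^(n+1)) D, entG d ε := by
  induction n with
  | zero => simp
  | succ n ih =>
    have hpos : 0 < D * (1/2)^(n+1) := by positivity
    have h1 : D * (1/2)^(n+1+1) ≤ D * (1/2)^(n+1) := by
      rw [pow_succ (1/2:ℝ) (n+1)]; nlinarith
    have h2 : D * (1/2)^(n+1) ≤ D := by
      have : ((1:ℝ)/2)^(n+1) ≤ 1 := pow_le_one₀ (by norm_num) (by norm_num)
      nlinarith
    rw [← Set.Ioc_union_Ioc_eq_Ioc h1 h2, lintegral_union measurableSet_Ioc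
      (by rw [Set.disjoint_left]; rintro x ⟨_, hx⟩ ⟨hy, _⟩; linarith),
      Finset.sum_range_succ, add_comm]
    refine add_le_add ?_ ih
    calc _ = ∫⁻ ε in Set.Ioc (D * (1/2)^(n+1+1)) (D * (1/2)^(n+1)), entG d (D * (1/2)^(n+1)) := by
          rw [setLIntegral_const, Real.volume_Ioc, mul_comm]
          congr 2
          ring
      _ ≤ _ := setLIntegral_mono' measurableSet_Ioc fun x hx => entG_anti d hx.2

lemma moment_bound {Ω : Type} [MeasurableSpace Ω] (μ : Measure Ω) [IsProbabilityMeasure μ]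
    (X : Ω → ℝ) (hX : Measurable X) (r : ℝ) (hr : 0 < r)
    (h : ∀ z : ℝ, 0 < z → μ {ω | z < |X ω|} ≤ ENNReal.ofReal (2 * Real.exp (-z^2 / (2 * r^2)))) :
    ∫⁻ ω, ENNReal.ofReal (Real.exp (X ω ^ 2 / (4 * r^2))) ∂μ ≤ 3 := by
  rw [lintegral_eq_lintegral_meas_lt μ (Filter.Eventually.of_forall fun ω => (Real.exp_pos _).le)
    (by fun_prop)]
  rw [← Set.Ioc_union_Ioi_eq_Ioi (show (0:ℝ) ≤ 1 by norm_num), lintegral_union measurableSet_Ioi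
      (by rw [Set.disjoint_left]; rintro x ⟨_, hx⟩ hy; simp only [Set.mem_Ioi] at hy; linarith)]
  have e1 : ∫⁻ t in Set.Ioc (0:ℝ) 1, μ {a | t < Real.exp (X a ^ 2 / (4 * r^2))} ≤ 1 := by
    calc _ ≤ ∫⁻ t in Set.Ioc (0:ℝ) 1, 1 := lintegral_mono fun t => prob_le_one
      _ = 1 := by simp
  have e2 : ∫⁻ t in Set.Ioi (1:ℝ), μ {a | t < Real.exp (X a ^ 2 / (4 * r^2))} ≤ 2 := by
    calc _ ≤ ∫⁻ t in Set.Ioi (1:ℝ), ENNReal.ofReal (2 * t ^ (-2:ℝ)) := by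
          refine setLIntegral_mono' measurableSet_Ioi fun t ht => ?_
          have ht : 1 < t := ht
          have hl : 0 < Real.log t := Real.log_pos ht
          have hz : 0 < 2 * r * √(Real.log t) := by positivity
          refine le_trans (measure_mono ?_) ((h _ hz).trans (le_of_eq ?_))
          · intro a ha
            simp only [Set.mem_ofPred_eq] at ha ⊢
            rw [← Real.log_lt_iff_lt_exp (by linarith), lt_div_iff₀ (by positivity)] at ha
            apply lt_abs.2
            rw [← lt_abs]
            apply lt_of_pow_lt_pow_left₀ 2 (abs_nonneg _)
            rw [sq_abs, mul_pow, Real.sq_sqrt hl.le]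
            linarith
          · congr 2
            rw [Real.rpow_def_of_pos (by linarith), mul_pow, Real.sq_sqrt hl.le]
            congr 1
            field_simp
      _ = 2 := by
          rw [← ofReal_integral_eq_lintegral_ofReal]
          · rw [integral_const_mul, integral_Ioi_rpow_of_lt (by norm_num) (by norm_num)]
            norm_num
          · exact (integrableOn_Ioi_rpow_of_lt (by norm_num) (by norm_num)).const_mul _
          · filter_upwards [ae_restrict_mem measurableSet_Ioi] with t ht
            have ht : 1 < t := ht
            have : 0 < t := by linarith
            positivity
  calc _ ≤ (1:ENNReal) + 2 := add_le_add e1 e2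
    _ = 3 := by norm_num

/-- maximum of finitely many variables -/
lemma max_bound {Ω T : Type} [MeasurableSpace Ω] (μ : Measure Ω) [IsProbabilityMeasure μ]
    (S : Finset T) (X : T → Ω → ℝ) (hX : ∀ s, Measurable (X s)) (r : ℝ) (hr : 0 < r)
    (hS : 2 ≤ S.card)
    (h : ∀ s ∈ S, ∀ z : ℝ, 0 < z →
      μ {ω | z < |X s ω|} ≤ ENNReal.ofReal (2 * Real.exp (-z^2 / (2 * r^2)))) :
    ∫⁻ ω, ENNReal.ofReal (Real.exp (((S.sup fun s => ‖X s ω‖₊ : NNReal) : ℝ) ^ 2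
      / (5 * r * √(Real.log S.card))^2)) ∂μ ≤ 2 := by
  have hN : (2:ℝ) ≤ S.card := by exact_mod_cast hS
  set N : ℝ := ((S.card : ℕ) : ℝ) with hNdef
  have hlogN : 0 < Real.log N := Real.log_pos (by linarith)
  have hl2 : 0.6931 < Real.log 2 := by have := Real.log_two_gt_d9; linarith
  have hl3N : Real.log (3 * N) ≤ 3 * Real.log N := by
    rw [← Real.log_rpow (by linarith)]
    apply Real.log_le_log (by linarith)
    norm_num
    nlinarith [mul_nonneg (show 0 ≤ N by linarith) (show 0 ≤ N^2-3 by nlinarith)]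
  have h23 : Real.log 2 ≤ Real.log (3*N) := Real.log_le_log (by norm_num) (by linarith)
  have hl3pos : 0 < Real.log (3*N) := by linarith
  set θ := Real.log 2 / Real.log (3*N) with hθ
  have hθ0 : 0 < θ := by positivity
  have hθ1 : θ ≤ 1 := by rw [hθ, div_le_one hl3pos]; exact h23
  have hpt : ∀ ω, ENNReal.ofReal (Real.exp (((S.sup fun s => ‖X s ω‖₊ : NNReal) : ℝ) ^ 2
      / (5 * r * √(Real.log N))^2)) ≤
      (∑ s ∈ S, ENNReal.ofReal (Real.exp (X s ω ^2 / (4 * r^2)))) * ENNReal.ofReal (2 * θ / (3*N))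
        + ENNReal.ofReal (2 * (1 - θ)) := by
    intro ω
    obtain ⟨s0, hs0, hs⟩ := Finset.exists_mem_eq_sup S (Finset.card_pos.1 (by omega))
      (fun s => ‖X s ω‖₊)
    rw [hs]
    simp only [coe_nnnorm, Real.norm_eq_abs, sq_abs]
    rw [← ENNReal.ofReal_sum_of_nonneg (fun _ _ => (Real.exp_pos _).le),
      ← ENNReal.ofReal_mul (Finset.sum_nonneg fun _ _ => (Real.exp_pos _).le),
      ← ENNReal.ofReal_add (by positivity) (by linarith)]
    apply ENNReal.ofReal_le_ofReal
    have h1 : Real.exp (X s0 ω ^2 / (4 * r^2)) ≤ ∑ s ∈ S, Real.exp (X s ω ^2 / (4 * r^2)) :=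
      Finset.single_le_sum (f := fun s => Real.exp (X s ω ^2 / (4 * r^2)))
        (fun _ _ => (Real.exp_pos _).le) hs0
    set w := X s0 ω ^2 / (4 * r^2) with hw
    have h2 : X s0 ω ^ 2 / (5 * r * √(Real.log N))^2 ≤ θ * w := by
      rw [mul_pow, Real.sq_sqrt hlogN.le, hθ, hw, div_mul_div_comm]
      rw [div_le_div_iff₀ (by positivity) (by positivity)]
      have : Real.log (3 * N) * 4 ≤ Real.log 2 * (25 * Real.log N) := by nlinarith
      have hp : 0 ≤ X s0 ω ^2 * r^2 := by positivity
      nlinarith [mul_le_mul_of_nonneg_left this hp]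
    have h3 : Real.exp (θ * w) ≤ 2 * (θ * (Real.exp w / (3*N)) + (1-θ)) := by
      have hc := convexOn_exp.2 (Set.mem_univ (w - Real.log (3*N))) (Set.mem_univ 0)
        hθ0.le (sub_nonneg.2 hθ1) (by ring)
      simp only [smul_eq_mul, mul_zero, add_zero, Real.exp_zero, mul_one] at hc
      rw [Real.exp_sub, Real.exp_log (by linarith)] at hc
      have : θ * w = Real.log 2 + θ * (w - Real.log (3*N)) := by
        rw [hθ]; field_simp; ring
      rw [this, Real.exp_add, Real.exp_log (by norm_num)]
      linarith
    calc _ ≤ Real.exp (θ * w) := Real.exp_le_exp.2 h2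
      _ ≤ _ := h3
      _ = Real.exp w * (2 * θ / (3 * N)) + 2 * (1-θ) := by ring
      _ ≤ _ := by gcongr
  have hsum : ∫⁻ ω, (∑ s ∈ S, ENNReal.ofReal (Real.exp (X s ω ^2 / (4 * r^2)))) ∂μ
      ≤ ENNReal.ofReal (3 * N) := by
    rw [lintegral_finsetSum _ (fun s _ => by have := hX s; fun_prop)]
    calc _ ≤ ∑ s ∈ S, (3:ENNReal) :=
          Finset.sum_le_sum fun s hs => moment_bound μ (X s) (hX s) r hr (h s hs)
      _ = _ := by
        rw [Finset.sum_const, hNdef, nsmul_eq_mul, ENNReal.ofReal_mul (by norm_num),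
          ENNReal.ofReal_natCast, mul_comm]
        norm_num
  calc _ ≤ ∫⁻ ω, ((∑ s ∈ S, ENNReal.ofReal (Real.exp (X s ω ^2 / (4 * r^2)))) *
          ENNReal.ofReal (2 * θ / (3*N)) + ENNReal.ofReal (2 * (1 - θ))) ∂μ := lintegral_mono hpt
    _ = (∫⁻ ω, (∑ s ∈ S, ENNReal.ofReal (Real.exp (X s ω ^2 / (4 * r^2)))) ∂μ) *
          ENNReal.ofReal (2 * θ / (3*N)) + ENNReal.ofReal (2 * (1 - θ)) := by
        rw [lintegral_add_right _ measurable_const, lintegral_mul_const' _ _ ENNReal.ofReal_ne_top]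
        simp
    _ ≤ ENNReal.ofReal (3 * N) * ENNReal.ofReal (2 * θ / (3*N)) + ENNReal.ofReal (2 * (1 - θ)) := by
        gcongr
    _ = 2 := by
        rw [← ENNReal.ofReal_mul (by linarith), ← ENNReal.ofReal_add (by positivity) (by linarith)]
        rw [show 3 * N * (2 * θ / (3 * N)) + 2 * (1-θ) = 2 by field_simp; ring]
        norm_num

lemma sum_bound {Ω : Type} [MeasurableSpace Ω] (μ : Measure Ω) [IsProbabilityMeasure μ]
    (M : ℕ → Ω → ℝ) (hM : ∀ k, Measurable (M k)) (c : ℕ → ℝ)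
    (hc : ∀ k, 0 < c k)
    (h : ∀ k, ∫⁻ ω, ENNReal.ofReal (Real.exp (M k ω ^ 2 / c k ^ 2)) ∂μ ≤ 2)
    (n : ℕ) (C : ℝ) (hC : ∑ k ∈ Finset.range (n+1), c k ≤ C) :
    ∫⁻ ω, ENNReal.ofReal (Real.exp ((∑ k ∈ Finset.range (n+1), M k ω) ^ 2 / C ^ 2)) ∂μ ≤ 2 := by
  set B := ∑ k ∈ Finset.range (n+1), c k with hB
  have hB0 : 0 < B := Finset.sum_pos (fun k _ => hc k) (by simp)
  have hw0 : ∀ k ∈ Finset.range (n+1), 0 ≤ c k / B := fun k _ => by have := hc k; positivity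
  have hw1 : ∑ k ∈ Finset.range (n+1), c k / B = 1 := by
    rw [← Finset.sum_div, ← hB, div_self hB0.ne']
  have hpt : ∀ ω, ENNReal.ofReal (Real.exp ((∑ k ∈ Finset.range (n+1), M k ω) ^ 2 / C ^ 2)) ≤
      ∑ k ∈ Finset.range (n+1), ENNReal.ofReal (c k / B) *
        ENNReal.ofReal (Real.exp (M k ω ^ 2 / c k ^ 2)) := by
    intro ω
    have : ∀ k ∈ Finset.range (n+1), ENNReal.ofReal (c k / B) *
        ENNReal.ofReal (Real.exp (M k ω ^ 2 / c k ^ 2)) =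
        ENNReal.ofReal (c k / B * Real.exp (M k ω ^ 2 / c k ^ 2)) := fun k hk => by
      rw [ENNReal.ofReal_mul (hw0 k hk)]
    rw [Finset.sum_congr rfl this, ← ENNReal.ofReal_sum_of_nonneg
      (fun k hk => mul_nonneg (hw0 k hk) (Real.exp_pos _).le)]
    apply ENNReal.ofReal_le_ofReal
    have j1 := (Even.convexOn_pow (𝕜 := ℝ) (n := 2) (by decide)).map_sum_le hw0 hw1
      (p := fun k => M k ω / c k) (fun _ _ => Set.mem_univ _)
    have j2 := convexOn_exp.map_sum_le hw0 hw1
      (p := fun k => M k ω ^ 2 / c k ^ 2) (fun _ _ => Set.mem_univ _)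
    simp only [smul_eq_mul] at j1 j2
    refine le_trans (Real.exp_le_exp.2 ?_) j2
    have e : ∑ k ∈ Finset.range (n+1), c k / B * (M k ω / c k) =
        (∑ k ∈ Finset.range (n+1), M k ω) / B := by
      rw [Finset.sum_div]
      refine Finset.sum_congr rfl fun k _ => ?_
      have := (hc k).ne'
      field_simp
    rw [e] at j1
    simp only [div_pow] at j1
    refine le_trans ?_ j1
    gcongr
  calc _ ≤ _ := lintegral_mono hpt
    _ = ∑ k ∈ Finset.range (n+1), ENNReal.ofReal (c k / B) *
        ∫⁻ ω, ENNReal.ofReal (Real.exp (M k ω ^ 2 / c k ^ 2)) ∂μ := by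
      rw [lintegral_finsetSum _ (fun k _ => by have := hM k; fun_prop)]
      refine Finset.sum_congr rfl fun k _ => ?_
      rw [lintegral_const_mul' _ _ ENNReal.ofReal_ne_top]
    _ ≤ ∑ k ∈ Finset.range (n+1), ENNReal.ofReal (c k / B) * 2 := by
      gcongr with k _
      exact h k
    _ = 2 := by
      rw [← Finset.sum_mul, ← ENNReal.ofReal_sum_of_nonneg hw0, hw1]
      simp

lemma tail_le {T Ω : Type} [MeasurableSpace Ω] (μ : Measure Ω) (d : T → T → ℝ)
    (hd0 : ∀ s t, 0 ≤ d s t) (Z : T → Ω → ℝ)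
    (h : ∀ s t : T, ∀ z : ℝ, 0 < z →
      μ {ω | z < |Z s ω - Z t ω|} ≤ ENNReal.ofReal (2 * Real.exp (-z ^ 2 / (2 * d s t ^ 2))))
    (h0 : ∀ s t : T, d s t = 0 → ∀ᵐ ω ∂μ, Z s ω = Z t ω)
    (s t : T) (r : ℝ) (hr : d s t ≤ r) (z : ℝ) (hz : 0 < z) :
    μ {ω | z < |Z s ω - Z t ω|} ≤ ENNReal.ofReal (2 * Real.exp (-z ^ 2 / (2 * r ^ 2))) := by
  rcases (hd0 s t).eq_or_lt with he | hlt
  · have : μ {ω | z < |Z s ω - Z t ω|} = 0 := by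
      refine measure_mono_null ?_ (ae_iff.1 (h0 s t he.symm))
      intro ω hω hcon
      simp only [Set.mem_ofPred_eq] at hω
      rw [hcon] at hω
      simp at hω
      linarith
    rw [this]; exact zero_le
  · refine (h s t z hz).trans (ENNReal.ofReal_le_ofReal ?_)
    rw [neg_div, neg_div]
    gcongr

/-- final passage to the supremum -/
lemma sup_passage {T Ω : Type} [Countable T] [Nonempty T] [MeasurableSpace Ω] (μ : Measure Ω)
    [IsProbabilityMeasure μ] (Z : T → Ω → ℝ) (t0 : T)
    (A : ℕ → Ω → ℝ) (hA : ∀ n, Measurable (A n)) (hA0 : ∀ n ω, 0 ≤ A n ω)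
    (hmono : ∀ ω, Monotone fun n => A n ω) (C : ℝ)
    (hE : ∀ n, ∫⁻ ω, ENNReal.ofReal (Real.exp (A n ω ^ 2 / C ^ 2)) ∂μ ≤ 2)
    (hae : ∀ t : T, ∀ m : ℕ, ∀ᵐ ω ∂μ, ∃ n, |Z t ω - Z t0 ω| ≤ A n ω + 1 / ((m:ℝ) + 1)) :
    ∫⁻ ω, ENNReal.ofReal (Real.exp ((⨆ s : T, ⨆ t : T, |Z s ω - Z t ω|) ^ 2 / (2 * C) ^ 2) - 1) ∂μ
      ≤ 1 := by
  have hae' : ∀ᵐ ω ∂μ, ∀ t : T, ∀ m : ℕ, ∃ n, |Z t ω - Z t0 ω| ≤ A n ω + 1 / ((m:ℝ) + 1) :=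
    ae_all_iff.2 fun t => ae_all_iff.2 fun m => hae t m
  have hg : ∫⁻ ω, ⨆ n, ENNReal.ofReal (Real.exp (A n ω ^ 2 / C ^ 2)) ∂μ ≤ 2 := by
    rw [lintegral_iSup (fun n => by have := hA n; fun_prop)]
    · exact iSup_le hE
    · intro n m hnm ω
      apply ENNReal.ofReal_le_ofReal
      have := hmono ω hnm
      have h0 := hA0 n ω
      dsimp only at this
      apply Real.exp_le_exp.2
      gcongr
  have hpt : ∀ᵐ ω ∂μ,
      ENNReal.ofReal (Real.exp ((⨆ s : T, ⨆ t : T, |Z s ω - Z t ω|) ^ 2 / (2 * C) ^ 2) - 1) + 1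
      ≤ ⨆ n, ENNReal.ofReal (Real.exp (A n ω ^ 2 / C ^ 2)) := by
    filter_upwards [hae'] with ω hω
    set Y := ⨆ s : T, ⨆ t : T, |Z s ω - Z t ω| with hY
    have hY0 : 0 ≤ Y := Real.iSup_nonneg fun s => Real.iSup_nonneg fun t => abs_nonneg _
    have e : ENNReal.ofReal (Real.exp (Y ^ 2 / (2 * C) ^ 2) - 1) + 1 =
        ENNReal.ofReal (Real.exp (Y ^ 2 / (2 * C) ^ 2)) := by
      have : 1 ≤ Real.exp (Y ^ 2 / (2 * C) ^ 2) := Real.one_le_exp (by positivity)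
      rw [← ENNReal.ofReal_one, ← ENNReal.ofReal_add (by linarith) (by norm_num)]
      congr 1; ring
    rw [e]
    rcases hY0.eq_or_lt with h0 | hpos
    · rw [← h0]
      refine le_trans ?_ (le_iSup _ 0)
      apply ENNReal.ofReal_le_ofReal
      apply Real.exp_le_exp.2
      simp
      positivity
    · have hcont : Filter.Tendsto (fun y : ℝ => ENNReal.ofReal (Real.exp (y ^ 2 / (2 * C) ^ 2)))
          (nhdsWithin Y (Set.Iio Y)) (nhds (ENNReal.ofReal (Real.exp (Y ^ 2 / (2 * C) ^ 2)))) := by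
        have : Continuous (fun y : ℝ => ENNReal.ofReal (Real.exp (y ^ 2 / (2 * C) ^ 2))) :=
          ENNReal.continuous_ofReal.comp
            (Real.continuous_exp.comp ((continuous_pow 2).div_const _))
        exact (this.tendsto Y).mono_left nhdsWithin_le_nhds
      refine le_of_tendsto hcont ?_
      filter_upwards [self_mem_nhdsWithin, mem_nhdsWithin_of_mem_nhds (lt_mem_nhds hpos)] with y hy hy0
      have hy : y < Y := hy
      have hy0 : 0 < y := hy0
      obtain ⟨s, hs⟩ := exists_lt_of_lt_ciSup hy
      obtain ⟨t, ht⟩ := exists_lt_of_lt_ciSup hs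
      obtain ⟨m, hm⟩ := exists_nat_one_div_lt (show 0 < (|Z s ω - Z t ω| - y) / 2 by linarith)
      obtain ⟨n1, h1⟩ := hω s m
      obtain ⟨n2, h2⟩ := hω t m
      refine le_trans ?_ (le_iSup _ (max n1 n2))
      apply ENNReal.ofReal_le_ofReal
      apply Real.exp_le_exp.2
      have m1 : A n1 ω ≤ A (max n1 n2) ω := hmono ω (le_max_left n1 n2)
      have m2 : A n2 ω ≤ A (max n1 n2) ω := hmono ω (le_max_right n1 n2)
      have tri : |Z s ω - Z t ω| ≤ |Z s ω - Z t0 ω| + |Z t ω - Z t0 ω| := by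
        rw [abs_sub_comm (Z t ω)]; exact abs_sub_le _ _ _
      have hyA : y / 2 ≤ A (max n1 n2) ω := by linarith
      have : y ^ 2 / (2 * C) ^ 2 = (y / 2) ^ 2 / C ^ 2 := by
        rw [mul_pow, div_pow, div_div]
      rw [this]
      gcongr
  have hfin := (lintegral_mono_ae hpt).trans hg
  rw [lintegral_add_right _ measurable_const] at hfin
  simp only [lintegral_const, measure_univ, mul_one] at hfin
  rw [show (2:ENNReal) = 1 + 1 by norm_num] at hfin
  exact (ENNReal.add_le_add_iff_right ENNReal.one_ne_top).1 hfin

lemma psi_le {Ω : Type} [MeasurableSpace Ω] (μ : Measure Ω) (Y : Ω → ℝ) (c : ℝ) (hc : 0 < c)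
    (h : ∫⁻ ω, ENNReal.ofReal (Real.exp ((Y ω) ^ 2 / c ^ 2) - 1) ∂μ ≤ 1) :
    psi2OrliczNorm μ Y ≤ ENNReal.ofReal c := by
  unfold psi2OrliczNorm
  exact iInf_le_of_le c (iInf_le_of_le hc (iInf_le_of_le h le_rfl))

lemma meas_sup {Ω T : Type} [MeasurableSpace Ω] (S : Finset T) (f : T → Ω → NNReal)
    (hf : ∀ s, Measurable (f s)) : Measurable fun ω => S.sup fun s => f s ω := by
  classical
  induction S using Finset.induction_on with
  | empty => simp
  | insert a S _ ih =>
    simp only [Finset.sup_insert]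
    exact (hf a).sup ih

lemma main_case {T : Type} [Countable T] [Nonempty T] (d : T → T → ℝ)
    (hd0 : ∀ s t, 0 ≤ d s t) (hsymm : ∀ s t, d s t = d t s)
    (htri : ∀ s u t, d s t ≤ d s u + d u t)
    (D : ℝ) (hD : 0 < D) (hdD : ∀ s t, d s t ≤ D) (hDle : ∀ b, (∀ s t, d s t ≤ b) → D ≤ b)
    {Ω : Type} [MeasurableSpace Ω] (μ : Measure Ω) [IsProbabilityMeasure μ]
    (Z : T → Ω → ℝ) (hZ : ∀ t, Measurable (Z t))
    (h : ∀ s t : T, ∀ z : ℝ, 0 < z →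
      μ {ω | z < |Z s ω - Z t ω|} ≤ ENNReal.ofReal (2 * Real.exp (-z ^ 2 / (2 * d s t ^ 2))))
    (h0 : ∀ s t : T, d s t = 0 → ∀ᵐ ω ∂μ, Z s ω = Z t ω)
    (hI : ∫⁻ ε in Set.Ioc (0:ℝ) D, entG d ε ≠ ⊤) :
    psi2OrliczNorm μ (fun ω => ⨆ s : T, ⨆ t : T, |Z s ω - Z t ω|) ≤
      ENNReal.ofReal 40 * ∫⁻ ε in Set.Ioc (0:ℝ) D, entG d ε := by
  classical
  set I := ∫⁻ ε in Set.Ioc (0:ℝ) D, entG d ε with hIdef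
  have tail := tail_le μ d hd0 Z h h0
  have hsub : ∀ n : ℕ, ∑ k ∈ Finset.range n,
      ENNReal.ofReal (D * (1/2)^(k+2)) * entG d (D * (1/2)^(k+1)) ≤ I := fun n =>
    (ent_sum d hD n).trans (lintegral_mono_set
      (Set.Ioc_subset_Ioc_left (by positivity)))
  have hfin : ∀ k : ℕ, coveringNumber (D * (1/2)^(k+2)) (Set.univ : Set T) d ≠ ⊤ := by
    intro k hk
    apply hI
    have h1 := hsub (k+1)
    rw [Finset.sum_range_succ] at h1
    have : entG d (D * (1/2)^(k+1)) = ⊤ := by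
      unfold entG
      rw [show D * (1/2)^(k+1) / 2 = D * (1/2)^(k+2) by ring, if_pos hk]
    rw [this, ENNReal.mul_top (by simp; positivity)] at h1
    simpa using h1
  choose S hScard hScov using fun k => cov_attained d _ (hfin k)
  have hS2 : ∀ k, 2 ≤ (S k).card := by
    intro k
    by_contra hlt
    have h1 : (S k).card ≤ 1 := by omega
    rw [Finset.card_le_one] at h1
    have := hDle (D * (1/2)^(k+2) + D * (1/2)^(k+2)) fun s t => by
      obtain ⟨a, ha, ha'⟩ := hScov k s
      obtain ⟨b, hb, hb'⟩ := hScov k t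
      have := h1 a ha b hb
      subst this
      have := htri s a t
      rw [hsymm a t] at this
      linarith
    have h2 : ((1:ℝ)/2)^k ≤ 1 := pow_le_one₀ (by norm_num) (by norm_num)
    rw [pow_add] at this
    nlinarith
  have hent : ∀ k, entG d (D * (1/2)^(k+1)) = ENNReal.ofReal √(Real.log (S k).card) := by
    intro k
    unfold entG
    rw [show D * (1/2)^(k+1) / 2 = D * (1/2)^(k+2) by ring, if_neg (hfin k), ← hScard k]
    simp
  obtain ⟨t0⟩ := ‹Nonempty T›
  have : Nonempty T := ⟨t0⟩
  choose near hnear hneard using hScov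
  let prev : ℕ → T → T := fun k s => match k with
    | 0 => t0
    | j+1 => near j s
  have hprev : ∀ k s, d s (prev k s) ≤ D * (1/2)^k := by
    intro k s
    match k with
    | 0 => simpa [prev] using hdD s t0
    | j+1 =>
      refine (hneard j s).trans ?_
      have : 0 < ((1:ℝ)/2)^(j+1) := by positivity
      rw [pow_succ _ (j+1)]
      nlinarith
  let M : ℕ → Ω → ℝ := fun k ω => (((S k).sup fun s => ‖Z s ω - Z (prev k s) ω‖₊ : NNReal) : ℝ)
  have hM : ∀ k, Measurable (M k) := by
    intro k
    have : Measurable fun ω => ((S k).sup fun s => ‖Z s ω - Z (prev k s) ω‖₊ : NNReal) := by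
      exact meas_sup (S k) (fun s ω => ‖Z s ω - Z (prev k s) ω‖₊)
        (fun s => ((hZ s).sub (hZ _)).nnnorm)
    exact this.coe_nnreal_real
  have hM0 : ∀ k ω, 0 ≤ M k ω := fun k ω => NNReal.coe_nonneg _
  have hMle : ∀ k ω, ∀ s ∈ S k, |Z s ω - Z (prev k s) ω| ≤ M k ω := by
    intro k ω s hs
    have := Finset.le_sup (f := fun s => ‖Z s ω - Z (prev k s) ω‖₊) hs
    exact_mod_cast this
  let c : ℕ → ℝ := fun k => 5 * (D * (1/2)^k) * √(Real.log (S k).card)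
  have hc : ∀ k, 0 < c k := by
    intro k
    have : (2:ℝ) ≤ (S k).card := by exact_mod_cast hS2 k
    have := Real.log_pos (show (1:ℝ) < (S k).card by linarith)
    simp only [c]
    positivity
  have hMb : ∀ k, ∫⁻ ω, ENNReal.ofReal (Real.exp (M k ω ^ 2 / c k ^ 2)) ∂μ ≤ 2 := by
    intro k
    exact max_bound μ (S k) (fun s ω => Z s ω - Z (prev k s) ω) (fun s => (hZ s).sub (hZ _))
      (D * (1/2)^k) (by positivity) (hS2 k) (fun s _ z hz => tail s _ _ (hprev k s) z hz)
  have hcsum : ∀ n, ∑ k ∈ Finset.range n, c k ≤ 20 * I.toReal := by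
    intro n
    have h1 := ENNReal.toReal_mono hI (hsub n)
    have e : ∀ k ∈ Finset.range n, ENNReal.ofReal (D * (1/2)^(k+2)) * entG d (D * (1/2)^(k+1))
        = ENNReal.ofReal (c k / 20) := by
      intro k _
      rw [hent, ← ENNReal.ofReal_mul (by positivity)]
      congr 1
      simp only [c]
      ring
    rw [Finset.sum_congr rfl e, ← ENNReal.ofReal_sum_of_nonneg
      (fun k _ => by have := hc k; positivity), ENNReal.toReal_ofReal
      (Finset.sum_nonneg (fun k _ => by have := hc k; positivity)), ← Finset.sum_div] at h1
    linarith
  have hI0 : 0 < I.toReal := by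
    have := hcsum 1
    simp only [Finset.sum_range_one] at this
    have := hc 0
    linarith
  let A : ℕ → Ω → ℝ := fun n ω => ∑ k ∈ Finset.range (n+1), M k ω
  have hchain : ∀ n ω, ∀ s ∈ S n, |Z s ω - Z t0 ω| ≤ A n ω := by
    intro n ω
    induction n with
    | zero =>
      intro s hs
      simpa [A] using hMle 0 ω s hs
    | succ n ih =>
      intro s hs
      have h1 := ih (near n s) (hnear n s)
      have h2 := hMle (n+1) ω s hs
      have h3 := abs_sub_le (Z s ω) (Z (near n s) ω) (Z t0 ω)
      have h4 : A (n+1) ω = A n ω + M (n+1) ω := Finset.sum_range_succ _ _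
      have h5 : prev (n+1) s = near n s := rfl
      rw [h5] at h2
      linarith
  have key := sup_passage μ Z t0 A
    (fun n => Finset.measurable_fun_sum _ fun k _ => hM k)
    (fun n ω => Finset.sum_nonneg fun k _ => hM0 k ω)
    (fun ω => monotone_nat_of_le_succ fun n => by
      have h4 : A (n+1) ω = A n ω + M (n+1) ω := Finset.sum_range_succ _ _
      have := hM0 (n+1) ω
      linarith) (20 * I.toReal)
    (fun n => sum_bound μ M hM c hc hMb n _ (hcsum (n+1)))
    (by
      intro t m
      set δ : ℝ := 1 / ((m:ℝ) + 1) with hδ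
      have hδ0 : 0 < δ := by positivity
      rw [ae_iff]
      have hlim : Filter.Tendsto (fun n : ℕ => ENNReal.ofReal
          (2 * Real.exp (-δ ^ 2 / (2 * (D * (1/2)^(n+2)) ^ 2)))) Filter.atTop (nhds 0) := by
        rw [← ENNReal.ofReal_zero]
        apply ENNReal.tendsto_ofReal
        rw [← mul_zero (2:ℝ)]
        apply Filter.Tendsto.const_mul
        apply Real.tendsto_exp_atBot.comp
        have e : ∀ n : ℕ, -δ ^ 2 / (2 * (D * (1/2)^(n+2)) ^ 2) =
            (-(8 * δ^2 / D^2)) * 4 ^ n := by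
          intro n
          have : ((1:ℝ)/2)^(n+2) = (1/4) / 2^n := by
            rw [one_div_pow, pow_add]; field_simp; norm_num
          rw [this, show (4:ℝ)^n = ((2:ℝ)^n)^2 by rw [← pow_mul, mul_comm, pow_mul]; norm_num]
          field_simp
          norm_num
        simp_rw [e]
        apply Filter.Tendsto.const_mul_atTop_of_neg
        · have : 0 < 8 * δ^2 / D^2 := by positivity
          linarith
        · exact tendsto_pow_atTop_atTop_of_one_lt (by norm_num)
      refine le_antisymm (ge_of_tendsto hlim (Filter.Eventually.of_forall fun n => ?_)) zero_le
      refine le_trans (measure_mono ?_) (tail t (near n t) _ (hneard n t) δ hδ0)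
      intro ω hω
      simp only [Set.mem_ofPred_eq, not_exists, not_le] at hω ⊢
      have h1 := hω n
      have h2 := hchain n ω (near n t) (hnear n t)
      have h3 := abs_sub_le (Z t ω) (Z (near n t) ω) (Z t0 ω)
      linarith)
  refine (psi_le μ _ (2 * (20 * I.toReal)) (by positivity) key).trans (le_of_eq ?_)
  rw [show 2 * (20 * I.toReal) = 40 * I.toReal by ring, ENNReal.ofReal_mul (by norm_num),
    ENNReal.ofReal_toReal hI]

/-- Maximal inequality for sub-Gaussian processes: there is a universal constant `c > 0`
such that for every countable pseudometric space `(T, d)` of finite diameter and every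
process `(Z_t)` with sub-Gaussian increments w.r.t. `d`,
`‖sup_{s,t} |Z_s − Z_t|‖_{ψ₂} ≤ c ∫₀^{diam T} √(log N(ε/2, T, d)) dε`. -/
theorem stmt2 :
    ∃ c : ℝ, 0 < c ∧
      ∀ (T : Type) [Countable T] [Nonempty T] (d : T → T → ℝ),
        (∀ s t, 0 ≤ d s t) → (∀ t, d t t = 0) → (∀ s t, d s t = d t s) →
        (∀ s u t, d s t ≤ d s u + d u t) →
        BddAbove (Set.range fun p : T × T => d p.1 p.2) →
        ∀ (Ω : Type) [MeasurableSpace Ω] (μ : Measure Ω) [IsProbabilityMeasure μ]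
          (Z : T → Ω → ℝ),
          (∀ t, Measurable (Z t)) →
          (∀ s t : T, ∀ z : ℝ, 0 < z →
            μ {ω | z < |Z s ω - Z t ω|} ≤
              ENNReal.ofReal (2 * Real.exp (-z ^ 2 / (2 * d s t ^ 2)))) →
          (∀ s t : T, d s t = 0 → ∀ᵐ ω ∂μ, Z s ω = Z t ω) →
          psi2OrliczNorm μ (fun ω => ⨆ s : T, ⨆ t : T, |Z s ω - Z t ω|) ≤
            ENNReal.ofReal c *
              ∫⁻ ε in Set.Ioc (0 : ℝ) (⨆ p : T × T, d p.1 p.2),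
                (if coveringNumber (ε / 2) (Set.univ : Set T) d = ⊤ then (⊤ : ENNReal)
                 else ENNReal.ofReal
                   (Real.sqrt (Real.log ((coveringNumber (ε / 2) (Set.univ : Set T) d).toReal)))) := by
  refine ⟨40, by norm_num, ?_⟩
  intro T _ _ d hd0 hdd hsymm htri hbdd Ω _ μ _ Z hZ h h0
  set D := ⨆ p : T × T, d p.1 p.2 with hDdef
  have hdD : ∀ s t, d s t ≤ D := fun s t => le_ciSup hbdd (s, t)
  have hDle : ∀ b, (∀ s t, d s t ≤ b) → D ≤ b := fun b hb => ciSup_le fun p => hb _ _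
  have hD0 : 0 ≤ D := (hd0 _ _).trans (hdD (Classical.arbitrary T) (Classical.arbitrary T))
  change _ ≤ ENNReal.ofReal 40 * ∫⁻ ε in Set.Ioc (0:ℝ) D, entG d ε
  rcases hD0.eq_or_lt with he | hD
  · have hz : ∀ᵐ ω ∂μ, ∀ s t, Z s ω = Z t ω :=
      ae_all_iff.2 fun s => ae_all_iff.2 fun t =>
        h0 s t (le_antisymm ((hdD s t).trans he.symm.le) (hd0 s t))
    have hnull : ∀ c : ℝ, ∫⁻ ω, ENNReal.ofReal
        (Real.exp ((⨆ s : T, ⨆ t : T, |Z s ω - Z t ω|) ^ 2 / c ^ 2) - 1) ∂μ = 0 := by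
      intro c
      rw [← lintegral_zero (μ := μ)]
      apply lintegral_congr_ae
      filter_upwards [hz] with ω hω
      have : (⨆ s : T, ⨆ t : T, |Z s ω - Z t ω|) = 0 := by
        have : ∀ s t, |Z s ω - Z t ω| = 0 := fun s t => by rw [hω s t]; simp
        simp [this]
      rw [this]
      simp
    refine le_trans ?_ zero_le
    apply ENNReal.le_of_forall_pos_le_add
    intro ε hε _
    rw [zero_add]
    refine (psi_le μ _ (ε:ℝ) (by exact_mod_cast hε)
      ((hnull _).le.trans zero_le)).trans (le_of_eq ?_)
    simp
  · by_cases hI : ∫⁻ ε in Set.Ioc (0:ℝ) D, entG d ε = ⊤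
    · rw [hI, ENNReal.mul_top (by simp)]
      exact le_top
    · exact main_case d hd0 hsymm htri D hD hdD hDle μ Z hZ h h0 hI
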